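/- arXiv:1410.8070 — 2 statements merged into one kernel-verified Lean document; each statement's English description precedes it below -/
import Mathlib

section
/- Let K be a field and V a finite-dimensional K-vector space. Let J, I₁, I₂, I₃ be linear subspaces of V, and let g₁, g₂, g₃ : V ≃ V be K-linear automorphisms such that gᵢ(J) = J for each i = 1, 2, 3. Suppose that V is the internal direct sum of the three subspaces g₁(I₁), g₂(I₂), g₃(I₃) (i.e., these subspaces are independent and their sum is all of V). Then dim(I₁ ∩ J) + dim(I₂ ∩ J) + dim(I₃ ∩ J) ≤ dim J. -/
open Module

/-- An automorphism `g` with `g(J) = J` carries `I ⊓ J` onto a subspace of `g(I) ⊓ J`. -/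
theorem finrank_inf_le_finrank_map_inf_of_map_eq
    {K V : Type*} [Field K] [AddCommGroup V] [Module K V] [FiniteDimensional K V]
    (I J : Submodule K V) (g : V ≃ₗ[K] V) (hJ : J.map (g : V →ₗ[K] V) = J) :
    finrank K ↥(I ⊓ J) ≤ finrank K ↥(I.map (g : V →ₗ[K] V) ⊓ J) := by
  rw [← LinearEquiv.finrank_map_eq g (I ⊓ J)]
  exact Submodule.finrank_mono
    (le_inf (Submodule.map_mono inf_le_left) ((Submodule.map_mono inf_le_right).trans hJ.le))

/-- The dimensions of two disjoint subspaces add up to that of their span. -/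
theorem finrank_sup_eq_add_of_disjoint
    {K V : Type*} [Field K] [AddCommGroup V] [Module K V] [FiniteDimensional K V]
    {A B : Submodule K V} (h : Disjoint A B) :
    finrank K ↥(A ⊔ B) = finrank K A + finrank K B := by
  rw [← Submodule.finrank_sup_add_finrank_inf_eq, h.eq_bot, finrank_bot, add_zero]

/-- If `V` is the internal direct sum of `g₁(I₁), g₂(I₂), g₃(I₃)` where each automorphism
`gᵢ` preserves a subspace `J`, then `dim(I₁ ⊓ J) + dim(I₂ ⊓ J) + dim(I₃ ⊓ J) ≤ dim J`. -/
theorem dim_inter_sum_le_of_direct_sum_translates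
    {K V : Type*} [Field K] [AddCommGroup V] [Module K V] [FiniteDimensional K V]
    (J I₁ I₂ I₃ : Submodule K V)
    (g₁ g₂ g₃ : V ≃ₗ[K] V)
    (hJ₁ : J.map (g₁ : V →ₗ[K] V) = J)
    (hJ₂ : J.map (g₂ : V →ₗ[K] V) = J)
    (hJ₃ : J.map (g₃ : V →ₗ[K] V) = J)
    (hindep : iSupIndep
      ![I₁.map (g₁ : V →ₗ[K] V), I₂.map (g₂ : V →ₗ[K] V), I₃.map (g₃ : V →ₗ[K] V)])
    (hsup : I₁.map (g₁ : V →ₗ[K] V) ⊔ I₂.map (g₂ : V →ₗ[K] V) ⊔ I₃.map (g₃ : V →ₗ[K] V)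
      = (⊤ : Submodule K V)) :
    finrank K ↥(I₁ ⊓ J) + finrank K ↥(I₂ ⊓ J) + finrank K ↥(I₃ ⊓ J) ≤ finrank K ↥J := by
  have h12 : Disjoint (I₁.map (g₁ : V →ₗ[K] V)) (I₂.map (g₂ : V →ₗ[K] V)) :=
    hindep.pairwiseDisjoint (show (0 : Fin 3) ≠ 1 by decide)
  have h3 : Disjoint (I₁.map (g₁ : V →ₗ[K] V) ⊔ I₂.map (g₂ : V →ₗ[K] V))
      (I₃.map (g₃ : V →ₗ[K] V)) :=
    ((hindep 2).mono_right (sup_le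
      (le_iSup₂_of_le (0 : Fin 3) (by decide) le_rfl)
      (le_iSup₂_of_le (1 : Fin 3) (by decide) le_rfl))).symm
  calc
    _ ≤ finrank K ↥(I₁.map (g₁ : V →ₗ[K] V) ⊓ J) + finrank K ↥(I₂.map (g₂ : V →ₗ[K] V) ⊓ J)
        + finrank K ↥(I₃.map (g₃ : V →ₗ[K] V) ⊓ J) :=
      add_le_add (add_le_add (finrank_inf_le_finrank_map_inf_of_map_eq I₁ J g₁ hJ₁)
        (finrank_inf_le_finrank_map_inf_of_map_eq I₂ J g₂ hJ₂))
        (finrank_inf_le_finrank_map_inf_of_map_eq I₃ J g₃ hJ₃)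
    _ = finrank K ↥((I₁.map (g₁ : V →ₗ[K] V) ⊓ J ⊔ I₂.map (g₂ : V →ₗ[K] V) ⊓ J)
        ⊔ I₃.map (g₃ : V →ₗ[K] V) ⊓ J) := by
      rw [finrank_sup_eq_add_of_disjoint
          (h3.mono (sup_le_sup inf_le_left inf_le_left) inf_le_left),
        finrank_sup_eq_add_of_disjoint (h12.mono inf_le_left inf_le_left)]
    _ ≤ finrank K ↥J :=
      Submodule.finrank_mono (sup_le (sup_le inf_le_right inf_le_right) inf_le_right)
end

section
/- Let K be a commutative ring, W a finite type, and c : W → W → W → K a family of structure constants satisfying the commutativity identity c(u,v,w) = c(v,u,w) for all u, v, w ∈ W, and the associativity identity ∑_{x∈W} c(u,v,x)·c(x,w,y) = ∑_{x∈W} c(v,w,x)·c(u,x,y) for all u, v, w, y ∈ W. Let m be a type and d : W → m → ℕ a multidegree function such that whenever c(u,v,w) ≠ 0, one has d(u)(α) + d(v)(α) ≤ d(w)(α) for every α ∈ m. Define a(u,v,w) = c(u,v,w) if d(u)(α) + d(v)(α) = d(w)(α) for all α ∈ m, and a(u,v,w) = 0 otherwise. Then the family a also satisfies the commutativity identity and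 the associativity identity ∑_{x∈W} a(u,v,x)·a(x,w,y) = ∑_{x∈W} a(v,w,x)·a(u,x,y). -/
section

variable {K W m : Type*} [CommRing K] {c a : W → W → W → K} {d : W → m → ℕ}

/-- A product of two degenerated constants agrees with the original product when the total
multidegree is preserved. -/
theorem degenerate_mul_eq_of_degree_eq
    (hd : ∀ u v w, c u v w ≠ 0 → ∀ α, d u α + d v α ≤ d w α)
    (ha_eq : ∀ u v w, (∀ α, d u α + d v α = d w α) → a u v w = c u v w)
    (ha_ne : ∀ u v w, ¬ (∀ α, d u α + d v α = d w α) → a u v w = 0)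
    {u v w y : W} (h : ∀ α, d u α + d v α + d w α = d y α) (x : W) :
    a u v x * a x w y = c u v x * c x w y := by
  have a_zero : ∀ u v w, c u v w = 0 → a u v w = 0 := fun u v w hc => by
    by_cases he : ∀ α, d u α + d v α = d w α
    · rw [ha_eq u v w he, hc]
    · exact ha_ne u v w he
  by_cases h₁ : c u v x = 0
  · rw [a_zero _ _ _ h₁, h₁, zero_mul, zero_mul]
  by_cases h₂ : c x w y = 0
  · rw [a_zero _ _ _ h₂, h₂, mul_zero, mul_zero]
  have hx : ∀ α, d u α + d v α = d x α := fun α => by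
    have := hd _ _ _ h₁ α
    have := hd _ _ _ h₂ α
    have := h α
    omega
  rw [ha_eq u v x hx, ha_eq x w y fun α => by rw [← hx α, h α]]

/-- A product of two degenerated constants vanishes when the total multidegree is not
preserved. -/
theorem degenerate_mul_eq_zero_of_degree_ne
    (ha_ne : ∀ u v w, ¬ (∀ α, d u α + d v α = d w α) → a u v w = 0)
    {u v w y : W} (h : ¬ ∀ α, d u α + d v α + d w α = d y α) (x : W) :
    a u v x * a x w y = 0 := by
  by_cases h₁ : ∀ α, d u α + d v α = d x α
  · rw [ha_ne x w y fun h₂ => h fun α => by rw [h₁ α, h₂ α], mul_zero]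
  · rw [ha_ne u v x h₁, zero_mul]

end

/-- Given commutative associative structure constants `c` and a multidegree function `d`
satisfying `d u α + d v α ≤ d w α` whenever `c u v w ≠ 0`, the degenerated constants `a`
(equal to `c u v w` when equality of multidegrees holds for all `α`, and `0` otherwise)
again satisfy the commutativity and associativity identities. -/
theorem degenerate_structure_constants_comm_assoc
    {K : Type*} [CommRing K] {W : Type*} [Fintype W] {m : Type*}
    (c : W → W → W → K)
    (hcomm : ∀ u v w, c u v w = c v u w)
    (hassoc : ∀ u v w y, ∑ x, c u v x * c x w y = ∑ x, c v w x * c u x y)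
    (d : W → m → ℕ)
    (hd : ∀ u v w, c u v w ≠ 0 → ∀ α, d u α + d v α ≤ d w α)
    (a : W → W → W → K)
    (ha_eq : ∀ u v w, (∀ α, d u α + d v α = d w α) → a u v w = c u v w)
    (ha_ne : ∀ u v w, ¬ (∀ α, d u α + d v α = d w α) → a u v w = 0) :
    (∀ u v w, a u v w = a v u w) ∧
      (∀ u v w y, ∑ x, a u v x * a x w y = ∑ x, a v w x * a u x y) := by
  have acomm : ∀ u v w, a u v w = a v u w := fun u v w => by
    by_cases h : ∀ α, d u α + d v α = d w α
    · rw [ha_eq u v w h, ha_eq v u w fun α => by rw [add_comm, h α], hcomm]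
    · rw [ha_ne u v w h, ha_ne v u w fun h' => h fun α => by rw [add_comm, h' α]]
  refine ⟨acomm, fun u v w y => ?_⟩
  have hperm : ∀ α, d v α + d w α + d u α = d u α + d v α + d w α := fun α => by ring
  simp_rw [acomm u _ y]
  by_cases h : ∀ α, d u α + d v α + d w α = d y α
  · have h' : ∀ α, d v α + d w α + d u α = d y α := fun α => (hperm α).trans (h α)
    simp_rw [degenerate_mul_eq_of_degree_eq hd ha_eq ha_ne h,
      degenerate_mul_eq_of_degree_eq hd ha_eq ha_ne h', hassoc u v w y, hcomm u _ y]
  · have h' : ¬ ∀ α, d v α + d w α + d u α = d y α :=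
      fun h' => h fun α => (hperm α).symm.trans (h' α)
    simp_rw [degenerate_mul_eq_zero_of_degree_ne ha_ne h,
      degenerate_mul_eq_zero_of_degree_ne ha_ne h']
end
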